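/- Let X be a topological space with Cantor derivative operator d, and let W ⊆ X satisfy the Two condition. Let f : X → X be a function such that for every x ∈ X, f(x) ≠ x and {x, f(x)} is an atomic open set. Then f is an involution (f(f(x)) = x for all x); in particular, f is a bijection. -/

import Mathlib

/-- The Cantor derivative (derived set) operator of a topological space. -/
def cantorDeriv {X : Type*} [TopologicalSpace X] (A : Set X) : Set X :=
  {x | ∀ U : Set X, IsOpen U → x ∈ U → (A ∩ (U \ {x})).Nonempty}

/-- An atomic open set: a nonempty open set with no nonempty proper open subset. -/
def IsAtomicOpen {X : Type*} [TopologicalSpace X] (U : Set X) : Prop :=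
  IsOpen U ∧ U.Nonempty ∧ ∀ V : Set X, IsOpen V → V.Nonempty → V ⊆ U → V = U

/-- Two atomic open sets sharing a point are equal. -/
theorem IsAtomicOpen.eq_of_mem {X : Type*} [TopologicalSpace X] {U V : Set X}
    (hU : IsAtomicOpen U) (hV : IsAtomicOpen V) {x : X} (hxU : x ∈ U) (hxV : x ∈ V) : U = V := by
  have hUV : IsOpen (U ∩ V) := hU.1.inter hV.1
  have hne : (U ∩ V).Nonempty := ⟨x, hxU, hxV⟩
  exact (hU.2.2 _ hUV hne Set.inter_subset_left).symm.trans
    (hV.2.2 _ hUV hne Set.inter_subset_right)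

/-- If `W` satisfies the `Two` condition and `f` sends each point `x` to a point
`f x ≠ x` with `{x, f x}` an atomic open set, then `f` is an involution, and hence
a bijection. -/
theorem two_condition_partner_involutive {X : Type*} [TopologicalSpace X] (W : Set X)
    (hTwo : ∀ x : X,
      (x ∈ W → x ∉ cantorDeriv W ∧ x ∈ cantorDeriv Wᶜ) ∧
      (x ∉ W → x ∉ cantorDeriv Wᶜ ∧ x ∈ cantorDeriv W))
    (f : X → X)
    (hf : ∀ x : X, f x ≠ x ∧ IsAtomicOpen ({x, f x} : Set X)) :
    (∀ x : X, f (f x) = x) ∧ Function.Bijective f := by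
  have hinv : Function.Involutive f := fun x => by
    have heq : ({f x, f (f x)} : Set X) = {x, f x} :=
      (hf (f x)).2.eq_of_mem (hf x).2 (x := f x) (by simp) (by simp)
    have hmem : f (f x) ∈ ({x, f x} : Set X) := heq ▸ by simp
    exact hmem.resolve_right (hf (f x)).1
  exact ⟨hinv, hinv.bijective⟩
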